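/- Let H = ⨁_{n≥1} ℂⁿ (Hilbert space direct sum) and let M ⊆ B(H) be the von Neumann algebra of all block-diagonal operators ⨁_n a_n with a_n ∈ B(ℂⁿ) for each n and sup_n ‖a_n‖ < ∞ (the ℓ∞-direct sum of the matrix algebras M_n(ℂ)). Then M admits no classically normal, singular pure state. -/

import Mathlib

open scoped ComplexOrder InnerProductSpace
open Filter Topology

set_option synthInstance.maxHeartbeats 1000000
set_option maxHeartbeats 1000000

noncomputable instance {H : Type*} [NormedAddCommGroup H] [InnerProductSpace ℂ H]
    [CompleteSpace H] : SMulMemClass (VonNeumannAlgebra H) ℂ (H →L[ℂ] H) :=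
  ⟨fun {s} c {_} hx => s.toStarSubalgebra.smul_mem hx c⟩

/-- The σ-weak (ultraweak, weak*) topology on `B(H)`: the initial topology induced by the
functionals `x ↦ ∑' n, ⟪ξ n, x (η n)⟫` over all pairs of square-summable sequences. -/
noncomputable def sigmaWeak (H : Type*) [NormedAddCommGroup H] [InnerProductSpace ℂ H]
    [CompleteSpace H] : TopologicalSpace (H →L[ℂ] H) :=
  ⨅ (ξ : ℕ → H) (η : ℕ → H) (_ : Summable fun n => ‖ξ n‖ ^ 2)
    (_ : Summable fun n => ‖η n‖ ^ 2),
    TopologicalSpace.induced (fun x : H →L[ℂ] H => ∑' n, ⟪ξ n, x (η n)⟫_ℂ) inferInstance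

variable {H : Type*} [NormedAddCommGroup H] [InnerProductSpace ℂ H] [CompleteSpace H]

/-- A positive linear functional on a von Neumann algebra. -/
def IsPosFunctional (M : VonNeumannAlgebra H) (f : ↥M →ₗ[ℂ] ℂ) : Prop :=
  ∀ a : ↥M, 0 ≤ f (star a * a)

/-- A state on a von Neumann algebra: a positive linear functional sending `1` to `1`. -/
def IsStateOn (M : VonNeumannAlgebra H) (f : ↥M →ₗ[ℂ] ℂ) : Prop :=
  IsPosFunctional M f ∧ f 1 = 1

/-- A pure state: a state such that every positive linear functional it dominates is a
nonnegative scalar multiple of it. -/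
def IsPureStateOn (M : VonNeumannAlgebra H) (f : ↥M →ₗ[ℂ] ℂ) : Prop :=
  IsStateOn M f ∧ ∀ g : ↥M →ₗ[ℂ] ℂ, IsPosFunctional M g → IsPosFunctional M (f - g) →
    ∃ t : ℝ, 0 ≤ t ∧ g = (t : ℂ) • f

/-- A functional on a von Neumann algebra is normal if it is continuous for the σ-weak
topology. -/
def IsNormalOn (M : VonNeumannAlgebra H) (f : ↥M →ₗ[ℂ] ℂ) : Prop :=
  @Continuous ↥M ℂ
    (TopologicalSpace.induced (fun x : ↥M => (x : H →L[ℂ] H)) (sigmaWeak H)) _ f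

/-- A state on a von Neumann algebra is singular if the only normal positive linear
functional it dominates is `0`. -/
def IsSingularOn (M : VonNeumannAlgebra H) (f : ↥M →ₗ[ℂ] ℂ) : Prop :=
  ∀ g : ↥M →ₗ[ℂ] ℂ, IsPosFunctional M g → IsPosFunctional M (f - g) → IsNormalOn M g → g = 0

/-- A projection: a self-adjoint idempotent. -/
def IsProjection (p : H →L[ℂ] H) : Prop := star p = p ∧ p * p = p

/-- `q` is a subprojection of `p` (i.e. `q ≤ p` for projections). -/
def ProjLE (q p : H →L[ℂ] H) : Prop := q * p = q ∧ p * q = q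

/-- `p` is a minimal projection of the set `S`: a nonzero projection in `S` such that the
only projections of `S` below `p` are `0` and `p`. -/
def IsMinimalProjectionIn (S : Set (H →L[ℂ] H)) (p : H →L[ℂ] H) : Prop :=
  p ∈ S ∧ IsProjection p ∧ p ≠ 0 ∧
    ∀ q ∈ S, IsProjection q → ProjLE q p → q = 0 ∨ q = p

/-- `f` is multiplicative on the subset `C` of `M`. -/
def IsMultiplicativeOn (M : VonNeumannAlgebra H) (f : ↥M →ₗ[ℂ] ℂ)
    (C : Set (H →L[ℂ] H)) : Prop :=
  ∀ a b : ↥M, (a : H →L[ℂ] H) ∈ C → (b : H →L[ℂ] H) ∈ C → f (a * b) = f a * f b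

/-- `f` is normal on the von Neumann subalgebra `C` of `M` (where `C ⊆ M`): the restriction
of `f` to `C` is σ-weakly continuous. -/
def IsNormalOnSub (M : VonNeumannAlgebra H) (f : ↥M →ₗ[ℂ] ℂ) (C : VonNeumannAlgebra H)
    (hC : (C : Set (H →L[ℂ] H)) ⊆ M) : Prop :=
  @Continuous ↥C ℂ
    (TopologicalSpace.induced (fun x : ↥C => (x : H →L[ℂ] H)) (sigmaWeak H)) _
    (fun x => f ⟨x, hC x.2⟩)

/-- A state on `M` is classically normal if it is normal on every von Neumann subalgebra
of `M` (with the same unit) on which it is multiplicative. -/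
def IsClassicallyNormalOn (M : VonNeumannAlgebra H) (f : ↥M →ₗ[ℂ] ℂ) : Prop :=
  ∀ (C : VonNeumannAlgebra H) (hC : (C : Set (H →L[ℂ] H)) ⊆ M),
    IsMultiplicativeOn M f (C : Set (H →L[ℂ] H)) → IsNormalOnSub M f C hC

/-- A von Neumann algebra is a factor if its center consists of the scalar multiples of
the identity. -/
def IsFactor (N : VonNeumannAlgebra H) : Prop :=
  ∀ x ∈ N, (∀ y ∈ N, x * y = y * x) → ∃ c : ℂ, x = c • (1 : H →L[ℂ] H)

/-- A positive operator on a Hilbert space. -/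
def IsPositiveOp (a : H →L[ℂ] H) : Prop :=
  star a = a ∧ ∀ v : H, 0 ≤ ⟪v, a v⟫_ℂ

/-- The Hilbert space direct sum `⨁_{n ≥ 1} ℂⁿ` (indexed here by `n + 1` for `n : ℕ`). -/
noncomputable abbrev HSum : Type := lp (fun n : ℕ => EuclideanSpace ℂ (Fin (n + 1))) 2

/-- The `n`-th summand `ℂ^{n+1}` of `⨁_{n ≥ 1} ℂⁿ`, as a subspace: the elements supported
in the `n`-th coordinate. -/
noncomputable def blockV (n : ℕ) : Submodule ℂ HSum where
  carrier := {x | ∀ m, m ≠ n → x m = 0}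
  add_mem' := by
    intro a b ha hb m hm
    have h : (↑(a + b) : ∀ i, EuclideanSpace ℂ (Fin (i + 1))) = ↑a + ↑b := lp.coeFn_add a b
    rw [show ((a + b : HSum) m) = a m + b m from congrFun h m, ha m hm, hb m hm, add_zero]
  zero_mem' := by
    intro m hm
    exact congrFun (lp.coeFn_zero (fun n : ℕ => EuclideanSpace ℂ (Fin (n + 1))) 2) m
  smul_mem' := by
    intro c a ha m hm
    have h : (↑(c • a) : ∀ i, EuclideanSpace ℂ (Fin (i + 1))) = c • ↑a := lp.coeFn_smul c a
    rw [show ((c • a : HSum) m) = c • a m from congrFun h m, ha m hm, smul_zero]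

theorem VonNeumannAlgebra.coe_smul_mem (M : VonNeumannAlgebra H) (c : ℂ) (a : ↥M) :
    ((c • a : ↥M) : H →L[ℂ] H) = c • (a : H →L[ℂ] H) := rfl

/-- The center of a von Neumann algebra, as a von Neumann algebra. -/
noncomputable def VonNeumannAlgebra.centerAlgebra (M : VonNeumannAlgebra H) :
    VonNeumannAlgebra H where
  toStarSubalgebra := StarSubalgebra.centralizer ℂ
    ((M : Set (H →L[ℂ] H)) ∪ (M.commutant : Set (H →L[ℂ] H)))
  centralizer_centralizer' := by simp

theorem VonNeumannAlgebra.mem_centerAlgebra {M : VonNeumannAlgebra H} {z : H →L[ℂ] H} :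
    z ∈ M.centerAlgebra ↔ z ∈ M ∧ ∀ a ∈ M, a * z = z * a := by
  change z ∈ StarSubalgebra.centralizer ℂ _ ↔ _
  rw [StarSubalgebra.mem_centralizer_iff]
  constructor
  · intro h
    refine ⟨?_, fun a ha => (h a (Or.inl ha)).1⟩
    rw [← M.commutant_commutant, mem_commutant_iff]
    exact fun g hg => (h g (Or.inr hg)).1
  · rintro ⟨hz, hc⟩ g (hg | hg)
    · exact ⟨hc g hg, hc _ (star_mem hg)⟩
    · exact ⟨(mem_commutant_iff.1 hg z hz).symm, (mem_commutant_iff.1 (star_mem hg) z hz).symm⟩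

/-- The functional `a ↦ f (w * a)`. -/
noncomputable def mulLeftFunctional (M : VonNeumannAlgebra H) (f : ↥M →ₗ[ℂ] ℂ) (w : ↥M) :
    ↥M →ₗ[ℂ] ℂ where
  toFun a := f (w * a)
  map_add' a b := by rw [mul_add, map_add]
  map_smul' c a := by
    rw [show w * (c • a) = c • (w * a) from Subtype.ext (mul_smul_comm _ _ _), map_smul]
    rfl

/-- If `z ∈ M` is a contraction, then `1 - star z * z` has the form `star s * s` with `s ∈ M`. -/
theorem VonNeumannAlgebra.exists_star_mul_self_eq_one_sub (M : VonNeumannAlgebra H) (z : ↥M)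
    (hz : ‖(z : H →L[ℂ] H)‖ ≤ 1) : ∃ s : ↥M, star s * s = 1 - star z * z := by
  set h : H →L[ℂ] H := 1 - star (z : H →L[ℂ] H) * z with hh
  have hpos : 0 ≤ h := by
    rw [hh, sub_nonneg, ← CStarAlgebra.norm_le_one_iff_of_nonneg _ (star_mul_self_nonneg _),
      CStarRing.norm_star_mul_self]
    exact mul_le_one₀ hz (norm_nonneg _) hz
  have hmem : h ∈ M := sub_mem (one_mem _) (mul_mem (star_mem z.2) z.2)
  have hs : CFC.sqrt h ∈ M := by
    rw [← M.commutant_commutant, mem_commutant_iff]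
    intro g hg
    have hc : Commute h g := mem_commutant_iff.1 hg h hmem
    rw [CFC.sqrt_eq_cfc]
    exact (hc.cfc_nnreal _).symm
  refine ⟨⟨_, hs⟩, Subtype.ext ?_⟩
  change star (CFC.sqrt h) * CFC.sqrt h = h
  rw [(IsSelfAdjoint.of_nonneg (CFC.sqrt_nonneg h)).star_eq, CFC.sqrt_mul_sqrt_self h hpos]

theorem IsPureStateOn.map_star_mul_self_mul_of_norm_le_one {M : VonNeumannAlgebra H}
    {f : ↥M →ₗ[ℂ] ℂ} (hf : IsPureStateOn M f) (z : ↥M) (hc : ∀ a : ↥M, a * z = z * a)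
    (hz : ‖(z : H →L[ℂ] H)‖ ≤ 1) (a : ↥M) : f (star z * z * a) = f (star z * z) * f a := by
  obtain ⟨⟨hpos, hone⟩, hpure⟩ := hf
  obtain ⟨s, hs⟩ := M.exists_star_mul_self_eq_one_sub z hz
  have hc' : ∀ a : ↥M, a * star z = star z * a := fun a => by
    simpa using (congrArg star (hc (star a))).symm
  have hcw : ∀ a : ↥M, a * (star z * z) = star z * z * a := fun a => by
    rw [← mul_assoc, hc', mul_assoc, hc, mul_assoc]
  obtain ⟨t, -, ht⟩ := hpure (mulLeftFunctional M f (star z * z))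
    (fun a => by
      change 0 ≤ f (star z * z * (star a * a))
      have := hpos (z * a)
      rwa [star_mul, mul_assoc, ← mul_assoc (star z), ← hcw, ← mul_assoc, hcw] at this)
    (fun a => by
      change 0 ≤ f (star a * a) - f (star z * z * (star a * a))
      have := hpos (s * a)
      rwa [star_mul, mul_assoc, ← mul_assoc (star s), hs, sub_mul, one_mul, mul_sub, ← hcw a,
        ← mul_assoc, hcw, map_sub] at this)
  have key : ∀ a, f (star z * z * a) = t * f a := fun a => LinearMap.congr_fun ht a
  have h1 := key 1
  rw [mul_one, hone, mul_one] at h1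
  rw [key, h1]

theorem IsPureStateOn.map_star_mul_self_mul {M : VonNeumannAlgebra H}
    {f : ↥M →ₗ[ℂ] ℂ} (hf : IsPureStateOn M f) (z : ↥M) (hc : ∀ a : ↥M, a * z = z * a)
    (a : ↥M) : f (star z * z * a) = f (star z * z) * f a := by
  by_cases h0 : (z : H →L[ℂ] H) = 0
  · rw [show z = 0 from Subtype.ext h0]
    simp
  have hn : (‖(z : H →L[ℂ] H)‖ : ℂ) ≠ 0 := by simpa using h0
  set r : ℂ := (‖(z : H →L[ℂ] H)‖ : ℂ) with hr
  have hzw : z = r • (r⁻¹ • z) := (smul_inv_smul₀ hn z).symm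
  have key := hf.map_star_mul_self_mul_of_norm_le_one (r⁻¹ • z)
    (fun b => Subtype.ext (by
      change (b : H →L[ℂ] H) * (r⁻¹ • (z : H →L[ℂ] H)) = (r⁻¹ • (z : H →L[ℂ] H)) * b
      rw [mul_smul_comm, smul_mul_assoc]
      exact congrArg _ (congrArg Subtype.val (hc b))))
    (by
      change ‖r⁻¹ • (z : H →L[ℂ] H)‖ ≤ 1
      rw [norm_smul, hr, norm_inv, Complex.norm_real, norm_norm, inv_mul_cancel₀]
      simpa using h0) a
  set w := r⁻¹ • z
  have e : star z * z = (star r * r) • (star w * w) := Subtype.ext (by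
    rw [hzw]
    change star (r • (w : H →L[ℂ] H)) * (r • (w : H →L[ℂ] H)) =
      (star r * r) • (star (w : H →L[ℂ] H) * w)
    rw [star_smul, smul_mul_smul_comm])
  have e' : (star r * r) • (star w * w) * a = (star r * r) • (star w * w * a) :=
    Subtype.ext (smul_mul_assoc _ _ _)
  rw [e, e', map_smul, map_smul, key, smul_eq_mul, smul_eq_mul]
  ring

/-- A pure state is multiplicative with respect to central elements. -/
theorem IsPureStateOn.map_central_mul {M : VonNeumannAlgebra H}
    {f : ↥M →ₗ[ℂ] ℂ} (hf : IsPureStateOn M f) (z : ↥M) (hc : ∀ a : ↥M, a * z = z * a)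
    (a : ↥M) : f (z * a) = f z * f a := by
  have hone := hf.1.2
  have polar : ∀ w : ↥M, (∀ b : ↥M, b * w = w * b) →
      f (w * a) + f (star w * a) = (f w + f (star w)) * f a := by
    intro w hw
    have h1 := hf.map_star_mul_self_mul (1 + w) (fun b => by rw [mul_add, add_mul, hw]; simp) a
    have h2 := hf.map_star_mul_self_mul w hw a
    simp only [star_add, star_one, add_mul, mul_add, one_mul, mul_one, map_add, hone] at h1
    linear_combination h1 - h2
  have h1 := polar z hc
  have hsm : ∀ (c : ℂ) (x y : ↥M), (c • x) * y = c • (x * y) :=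
    fun c x y => Subtype.ext (smul_mul_assoc _ _ _)
  have h2 := polar (Complex.I • z) (fun b => by
    rw [hsm, ← hc]
    exact Subtype.ext (mul_smul_comm _ _ _))
  have hst : star (Complex.I • z) = (-Complex.I) • star z := Subtype.ext (by
    change star (Complex.I • (z : H →L[ℂ] H)) = (-Complex.I) • star (z : H →L[ℂ] H)
    rw [star_smul]
    simp)
  rw [hst, hsm, hsm, map_smul, map_smul, map_smul, map_smul] at h2
  simp only [smul_eq_mul] at h2
  linear_combination (1 / 2 : ℂ) * h1 - (Complex.I / 2) * h2 +
    (1 / 2 : ℂ) * (f (z * a) - f (star z * a) - (f z - f (star z)) * f a) * Complex.I_sq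

theorem tendsto_sigmaWeak_of_strong {T : ℕ → H →L[ℂ] H} {L : H →L[ℂ] H} {K : ℝ}
    (hK : ∀ N x, ‖T N x‖ ≤ K * ‖x‖) (hT : ∀ x, Tendsto (fun N => T N x) atTop (𝓝 (L x))) :
    Tendsto T atTop (@nhds _ (sigmaWeak H) L) := by
  rw [sigmaWeak]
  simp only [nhds_iInf, nhds_induced, tendsto_iInf, tendsto_comap_iff]
  intro ξ η hξ hη
  refine tendsto_tsum_of_dominated_convergence (bound := fun k => ‖ξ k‖ * (K * ‖η k‖)) ?_ ?_ ?_
  · refine Summable.of_nonneg_of_le (fun k => ?_) (fun k => ?_) ((hξ.add hη).mul_left |K|)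
    · exact mul_nonneg (norm_nonneg _) ((norm_nonneg _).trans (hK 0 _))
    · have h := mul_le_mul_of_nonneg_right (le_abs_self K)
        (mul_nonneg (norm_nonneg (ξ k)) (norm_nonneg (η k)))
      nlinarith [mul_nonneg (abs_nonneg K) (sq_nonneg (‖ξ k‖ - ‖η k‖)),
        mul_nonneg (abs_nonneg K) (add_nonneg (sq_nonneg ‖ξ k‖) (sq_nonneg ‖η k‖))]
  · intro k
    exact tendsto_const_nhds.inner (hT _)
  · refine Eventually.of_forall fun N k => ?_
    exact (norm_inner_le_norm _ _).trans (mul_le_mul_of_nonneg_left (hK _ _) (norm_nonneg _))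

theorem continuous_sigmaWeak_inner (x y : H) :
    @Continuous _ _ (sigmaWeak H) _ (fun T : H →L[ℂ] H => ⟪x, T y⟫_ℂ) := by
  have hs : ∀ v : H, Summable fun n => ‖(Pi.single 0 v : ℕ → H) n‖ ^ 2 := fun v =>
    summable_of_ne_finset_zero (s := {0}) fun n hn => by
      rw [Pi.single_eq_of_ne (by simpa using hn)]; simp
  have h : (fun T : H →L[ℂ] H => ⟪x, T y⟫_ℂ) = fun T : H →L[ℂ] H =>
      ∑' n, ⟪(Pi.single 0 x : ℕ → H) n, T ((Pi.single 0 y : ℕ → H) n)⟫_ℂ := by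
    funext T
    rw [tsum_eq_single 0 fun n hn => by simp [Pi.single_eq_of_ne hn]]
    simp
  rw [h]
  refine continuous_iff_le_induced.2 ?_
  exact iInf_le_of_le _ (iInf_le_of_le _ (iInf_le_of_le (hs x) (iInf_le _ (hs y))))

/-- The `i`-th standard basis vector of the `n`-th block. -/
noncomputable def blockBasis (n : ℕ) (i : Fin (n + 1)) : HSum :=
  lp.single 2 n (EuclideanSpace.single i 1)

theorem single_mem_blockV (n : ℕ) (v : EuclideanSpace ℂ (Fin (n + 1))) :
    (lp.single 2 n v : HSum) ∈ blockV n :=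
  fun _ hm => lp.single_apply_ne (E := fun n : ℕ => EuclideanSpace ℂ (Fin (n + 1))) 2 n v hm

theorem eq_single_of_mem_blockV {n : ℕ} {x : HSum} (hx : x ∈ blockV n) :
    x = lp.single 2 n (x n) := by
  refine lp.ext (funext fun m => ?_)
  by_cases hm : m = n
  · subst hm; rw [lp.single_apply_self]
  · rw [hx m hm, lp.single_apply_ne 2 n _ hm]

/-- The projection onto the `n`-th block. -/
noncomputable def blockProj (n : ℕ) : HSum →L[ℂ] HSum :=
  ∑ i, InnerProductSpace.rankOne ℂ (blockBasis n i) (blockBasis n i)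

theorem blockProj_apply_eq_sum (n : ℕ) (x : HSum) :
    blockProj n x = ∑ i, ⟪blockBasis n i, x⟫_ℂ • blockBasis n i := by
  simp [blockProj]

theorem blockProj_apply (n : ℕ) (x : HSum) : blockProj n x = lp.single 2 n (x n) := by
  have h : x n = ∑ i, (x n) i • EuclideanSpace.single i (1 : ℂ) := by
    simpa using ((EuclideanSpace.basisFun (Fin (n + 1)) ℂ).sum_repr (x n)).symm
  have e : ∀ v : EuclideanSpace ℂ (Fin (n + 1)),
      (lp.single 2 n v : HSum) =
        lp.singleContinuousLinearMap ℂ (fun n : ℕ => EuclideanSpace ℂ (Fin (n + 1))) 2 n v :=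
    fun _ => rfl
  have hx : ∀ i, ⟪blockBasis n i, x⟫_ℂ = (x n) i := fun i => by
    rw [blockBasis, lp.inner_single_left]
    exact (EuclideanSpace.inner_single_left i (1 : ℂ) (x n)).trans (by simp)
  rw [blockProj_apply_eq_sum, h, e, map_sum]
  refine Finset.sum_congr rfl fun i _ => ?_
  rw [map_smul, hx]
  rfl

theorem norm_sum_blockProj_apply_le (N : ℕ) (x : HSum) :
    ‖(∑ n ∈ Finset.range N, blockProj n) x‖ ≤ 1 * ‖x‖ := by
  have h2 : (0 : ℝ) < (2 : ENNReal).toReal := by simp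
  simp only [sum_apply, blockProj_apply, one_mul]
  rw [← Real.rpow_le_rpow_iff (norm_nonneg _) (norm_nonneg _) h2,
    lp.norm_sum_single h2 (fun n => x n)]
  exact lp.sum_rpow_le_norm_rpow h2 x _

theorem tendsto_sum_blockProj (x : HSum) :
    Tendsto (fun N => (∑ n ∈ Finset.range N, blockProj n) x) atTop
      (𝓝 ((1 : HSum →L[ℂ] HSum) x)) := by
  simp only [sum_apply, blockProj_apply]
  exact (lp.hasSum_single ENNReal.ofNat_ne_top x).tendsto_sum_nat

/-- Block-diagonal operators commute with the block projections. -/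
theorem commute_blockProj {T : HSum →L[ℂ] HSum}
    (hT : ∀ n : ℕ, ∀ x : HSum, x ∈ blockV n → T x ∈ blockV n) (n : ℕ) :
    T * blockProj n = blockProj n * T := by
  refine ContinuousLinearMap.ext fun x => ?_
  have hs := (lp.hasSum_single ENNReal.ofNat_ne_top x).mapL (blockProj n * T)
  refine HasSum.unique ?_ hs
  have h : ∀ m, m ≠ n → (blockProj n * T) (lp.single 2 m (x m)) = 0 := fun m hm => by
    rw [mul_apply_eq_comp, blockProj_apply, hT m _ (single_mem_blockV m _) n hm.symm,
      lp.single_zero]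
  convert hasSum_single n h using 1
  rw [mul_apply_eq_comp, mul_apply_eq_comp, blockProj_apply n x,
    blockProj_apply]
  exact eq_single_of_mem_blockV (hT n _ (single_mem_blockV n _))

theorem rankOne_blockBasis_preserves_blockV (n : ℕ) (i j : Fin (n + 1)) (m : ℕ) (x : HSum)
    (hx : x ∈ blockV m) :
    InnerProductSpace.rankOne ℂ (blockBasis n i) (blockBasis n j) x ∈ blockV m := by
  rw [InnerProductSpace.rankOne_apply]
  by_cases hm : m = n
  · subst hm
    exact (blockV m).smul_mem _ (single_mem_blockV m _)
  · rw [blockBasis, blockBasis, lp.inner_single_left, hx n (Ne.symm hm)]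
    simp

theorem blockProj_idem (n : ℕ) : blockProj n * blockProj n = blockProj n := by
  refine ContinuousLinearMap.ext fun x => ?_
  rw [mul_apply_eq_comp, blockProj_apply, blockProj_apply, lp.single_apply_self]

/-- The corner of a block-diagonal operator expands in matrix units. -/
theorem blockProj_mul_eq_sum {T : HSum →L[ℂ] HSum}
    (hT : ∀ n : ℕ, ∀ x : HSum, x ∈ blockV n → T x ∈ blockV n) (n : ℕ) :
    blockProj n * T = ∑ i, ∑ j, ⟪blockBasis n i, T (blockBasis n j)⟫_ℂ •
      InnerProductSpace.rankOne ℂ (blockBasis n i) (blockBasis n j) := by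
  refine ContinuousLinearMap.ext fun x => ?_
  rw [← blockProj_idem, mul_assoc, ← commute_blockProj hT]
  simp only [mul_apply_eq_comp, sum_apply,
    smul_apply, InnerProductSpace.rankOne_apply]
  rw [blockProj_apply_eq_sum n x, map_sum, map_sum, Finset.sum_comm]
  refine Finset.sum_congr rfl fun j _ => ?_
  rw [map_smul, map_smul, blockProj_apply_eq_sum, Finset.smul_sum]
  exact Finset.sum_congr rfl fun i _ => smul_comm _ _ _

/-- The von Neumann algebra `⨁_n B(ℂⁿ)` (the `ℓ∞`-direct sum of the matrix algebras
`M_n(ℂ)`) of block-diagonal operators — i.e. the bounded operators preserving every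
block `ℂⁿ` — admits no classically normal, singular pure state. -/
theorem no_classically_normal_singular_pure_state_on_matrix_sum
    (M : VonNeumannAlgebra HSum)
    (hM : (M : Set (HSum →L[ℂ] HSum)) =
      {T | ∀ n : ℕ, ∀ x : HSum, x ∈ blockV n → T x ∈ blockV n}) :
    ¬ ∃ f : ↥M →ₗ[ℂ] ℂ,
        IsPureStateOn M f ∧ IsSingularOn M f ∧ IsClassicallyNormalOn M f := by
  rintro ⟨f, hf, hsing, hcn⟩
  have hmem : ∀ T : HSum →L[ℂ] HSum,
      T ∈ M ↔ ∀ n : ℕ, ∀ x : HSum, x ∈ blockV n → T x ∈ blockV n := fun T => by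
    rw [← SetLike.mem_coe, hM]
    rfl
  have hr : ∀ n (i j : Fin (n + 1)),
      InnerProductSpace.rankOne ℂ (blockBasis n i) (blockBasis n j) ∈ M := fun n i j =>
    (hmem _).2 (rankOne_blockBasis_preserves_blockV n i j)
  have hE : ∀ n, blockProj n ∈ M := fun n => sum_mem fun i _ => hr n i i
  have hEc : ∀ n, blockProj n ∈ M.centerAlgebra := fun n =>
    VonNeumannAlgebra.mem_centerAlgebra.2
      ⟨hE n, fun a ha => commute_blockProj ((hmem a).1 ha) n⟩
  have hcM : (M.centerAlgebra : Set (HSum →L[ℂ] HSum)) ⊆ M := fun z hz =>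
    (VonNeumannAlgebra.mem_centerAlgebra.1 hz).1
  have hcen : ∀ z : ↥M, (z : HSum →L[ℂ] HSum) ∈ M.centerAlgebra → ∀ a, f (z * a) = f z * f a :=
    fun z hz a => hf.map_central_mul z (fun b =>
      Subtype.ext ((VonNeumannAlgebra.mem_centerAlgebra.1 hz).2 b b.2)) a
  have hnorm := hcn M.centerAlgebra hcM fun a b ha _ => hcen a ha b
  have hne : ∃ n, f ⟨blockProj n, hE n⟩ ≠ 0 := by
    by_contra! hzero
    let S : ℕ → ↥M.centerAlgebra := fun N =>
      ⟨∑ n ∈ Finset.range N, blockProj n, sum_mem fun n _ => hEc n⟩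
    have hS : Tendsto S atTop (@nhds _ (TopologicalSpace.induced
        (fun x : ↥M.centerAlgebra => (x : HSum →L[ℂ] HSum)) (sigmaWeak HSum)) 1) := by
      rw [@nhds_induced _ _ (sigmaWeak HSum), tendsto_comap_iff]
      exact tendsto_sigmaWeak_of_strong norm_sum_blockProj_apply_le tendsto_sum_blockProj
    have hlim := (@Continuous.tendsto _ _ (_) _ _ hnorm 1).comp hS
    have hz : ∀ N, f ⟨S N, hcM (S N).2⟩ = 0 := fun N => by
      have : (⟨S N, hcM (S N).2⟩ : ↥M) = ∑ n ∈ Finset.range N, ⟨blockProj n, hE n⟩ :=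
        Subtype.ext (by simp [S])
      rw [this, map_sum]
      exact Finset.sum_eq_zero fun n _ => hzero n
    have h01 : f 1 = 0 := tendsto_nhds_unique hlim (by
      simp only [Function.comp_def, hz]
      exact tendsto_const_nhds)
    rw [hf.1.2] at h01
    exact one_ne_zero h01
  obtain ⟨n, hn⟩ := hne
  have hn1 : f ⟨blockProj n, hE n⟩ = 1 := by
    have h := hcen ⟨blockProj n, hE n⟩ (hEc n) ⟨blockProj n, hE n⟩
    rw [show (⟨blockProj n, hE n⟩ : ↥M) * ⟨blockProj n, hE n⟩ = ⟨blockProj n, hE n⟩ from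
      Subtype.ext (blockProj_idem n)] at h
    exact (mul_left_cancel₀ hn (by rw [mul_one]; exact h)).symm
  have hform : ⇑f = fun a : ↥M => ∑ i, ∑ j,
      ⟪blockBasis n i, (a : HSum →L[ℂ] HSum) (blockBasis n j)⟫_ℂ * f ⟨_, hr n i j⟩ := by
    funext a
    have h := hcen ⟨blockProj n, hE n⟩ (hEc n) a
    rw [hn1, one_mul] at h
    have hexp : (⟨blockProj n, hE n⟩ : ↥M) * a = ∑ i, ∑ j,
        ⟪blockBasis n i, (a : HSum →L[ℂ] HSum) (blockBasis n j)⟫_ℂ • (⟨_, hr n i j⟩ : ↥M) := by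
      refine Subtype.ext ?_
      simp only [AddSubmonoidClass.coe_finsetSum, VonNeumannAlgebra.coe_smul_mem]
      exact blockProj_mul_eq_sum ((hmem a).1 a.2) n
    rw [← h, hexp]
    simp only [map_sum, map_smul, smul_eq_mul]
  have hfn : IsNormalOn M f := by
    unfold IsNormalOn
    rw [hform]
    let _ : TopologicalSpace ↥M :=
      TopologicalSpace.induced (fun x : ↥M => (x : HSum →L[ℂ] HSum)) (sigmaWeak HSum)
    refine continuous_finsetSum _ fun i _ => continuous_finsetSum _ fun j _ =>
      Continuous.mul ?_ continuous_const
    exact @Continuous.comp _ _ _ _ (sigmaWeak HSum) _ _ _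
      (continuous_sigmaWeak_inner _ _) continuous_induced_dom
  have hf0 := hsing f hf.1.1 (fun a => by simp) hfn
  have h1 := hf.1.2
  rw [hf0] at h1
  exact zero_ne_one h1
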